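/- Let p: ℝ^d → ℝ be integrable with all absolute moments finite, let β ≥ 1 be an integer, and let f: ℝ^d → ℝ have continuous bounded partial derivatives up to order β. For an integer b ≥ 0 define T^{(b)}_σ g = g − ∑_{i=1}^{b} ∑_{l : l.=i} d_l σ^i D^i_l g (so T^{(0)}_σ g = g). Then for every σ > 0 and every x ∈ ℝ^d the following identity holds: ∑_{j=1}^{β} ∑_{k : k.=j} [ ((−1)^j / k!) σ^j m_k ( (T^{(β−j)}_σ (D^j_k f))(x) − (D^j_k f)(x) ) − c_k σ^j (D^j_k f)(x) ] = 0. -/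

import Mathlib

open MeasureTheory ProbabilityTheory Filter Set
open scoped ENNReal NNReal Topology Real

noncomputable section

/-- The degree `k. = k₁ + ⋯ + k_d` of a multi-index. -/
def mdeg {d : ℕ} (k : Fin d → ℕ) : ℕ := ∑ j, k j

/-- The largest integer strictly smaller than `α` (for `α > 0`). -/
def lint (α : ℝ) : ℕ := ⌈α⌉₊ - 1

/-- Multi-index factorial `k! = k₁!⋯k_d!`. -/
def mfact {d : ℕ} (k : Fin d → ℕ) : ℕ := ∏ j, (k j).factorial

/-- The moment `m_k = ∫ y^k p(y) dy` of the kernel `p`. -/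
def mmom {d : ℕ} (p : (Fin d → ℝ) → ℝ) (k : Fin d → ℕ) : ℝ :=
  ∫ y, (∏ j, (y j) ^ (k j)) * p y

/-- The finite set of multi-indices of degree `j`. -/
def mIdx (d j : ℕ) : Finset (Fin d → ℕ) :=
  (Fintype.piFinset fun _ : Fin d => Finset.range (j + 1)).filter fun k => mdeg k = j

/-- Auxiliary recursion (on an upper bound for the degree) computing the numbers `d_n`
defined recursively by `d_n = -m_n/n!` for `n. = 1` and, for `n. ≥ 2`,
`d_n = (-1)^{n.} m_n/n! - ∑_{n=l+k, l.≥1, k.≥1} ((-1)^{k.}/k!) m_k d_l`. -/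
def dAux {d : ℕ} (p : (Fin d → ℝ) → ℝ) : ℕ → (Fin d → ℕ) → ℝ
  | 0, _ => 0
  | (N + 1), n =>
      if mdeg n = 1 then -(mmom p n) / (mfact n : ℝ)
      else (-1 : ℝ) ^ (mdeg n) * mmom p n / (mfact n : ℝ)
        - ∑ l ∈ (Fintype.piFinset fun j => Finset.range (n j + 1)).filter
            (fun l => 1 ≤ mdeg l ∧ l ≠ n),
            ((-1 : ℝ) ^ (mdeg (n - l)) / (mfact (n - l) : ℝ)) * mmom p (n - l) * dAux p N l

/-- The numbers `d_n`. -/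
def dcoef {d : ℕ} (p : (Fin d → ℝ) → ℝ) (n : Fin d → ℕ) : ℝ := dAux p (mdeg n) n

/-- The numbers `c_n`: `c_n = 0` if `n. = 1` and `c_n = d_n - (-1)^{n.} m_n/n!` if
`n. ≥ 2` (equivalently, `c_n = -∑_{n=l+k, l.≥1, k.≥1} ((-1)^{k.}/k!) m_k d_l`). -/
def ccoef {d : ℕ} (p : (Fin d → ℝ) → ℝ) (n : Fin d → ℕ) : ℝ :=
  if mdeg n ≤ 1 then 0
  else dcoef p n - (-1 : ℝ) ^ (mdeg n) * mmom p n / (mfact n : ℝ)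

/-- First-order partial derivative in direction `i`. -/
def pd {d : ℕ} (i : Fin d) (f : (Fin d → ℝ) → ℝ) : (Fin d → ℝ) → ℝ :=
  fun x => fderiv ℝ f x (Pi.single i 1)

/-- The partial derivative `D^j_k = ∂^{k.}/(∂x₁^{k₁}⋯∂x_d^{k_d})`. -/
def mpd {d : ℕ} (k : Fin d → ℕ) (f : (Fin d → ℝ) → ℝ) : (Fin d → ℝ) → ℝ :=
  (List.finRange d).foldr (fun i g => (pd i)^[k i] g) f

/-- The transform `T^{(b)}_σ f = f - ∑_{i=1}^{b} ∑_{l.=i} d_l σ^i D^i_l f`. -/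
def Tb {d : ℕ} (p : (Fin d → ℝ) → ℝ) (b : ℕ) (σ : ℝ)
    (f : (Fin d → ℝ) → ℝ) : (Fin d → ℝ) → ℝ :=
  fun x => f x - ∑ i ∈ Finset.Icc 1 b, ∑ l ∈ mIdx d i, dcoef p l * σ ^ i * mpd l f x

/-- The transform `T_{α,σ} f = f - ∑_{j=1}^{β} ∑_{k.=j} d_k σ^j D^j_k f`, `β = lint α`. -/
def Ttrans {d : ℕ} (p : (Fin d → ℝ) → ℝ) (α σ : ℝ)
    (f : (Fin d → ℝ) → ℝ) : (Fin d → ℝ) → ℝ :=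
  Tb p (lint α) σ f

/-- Convolution on `ℝ^d`: `(f * g)(x) = ∫ f(x-y) g(y) dy`. -/
def conv {d : ℕ} (f g : (Fin d → ℝ) → ℝ) (x : Fin d → ℝ) : ℝ :=
  ∫ y, f (x - y) * g y

/-- The rescaled kernel `p_σ(x) = σ^{-d} p(x/σ)`. -/
def psig {d : ℕ} (p : (Fin d → ℝ) → ℝ) (σ : ℝ) (x : Fin d → ℝ) : ℝ :=
  (1 / σ ^ d) * p fun j => x j / σ

/-- The iterated partial derivative along a word of directions. -/
def wordDeriv {d : ℕ} (w : List (Fin d)) (f : (Fin d → ℝ) → ℝ) : (Fin d → ℝ) → ℝ :=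
  w.foldr pd f

/-- The sorted word in which the letter `i` occurs `k i` times. -/
def multiWord {d : ℕ} (k : Fin d → ℕ) : List (Fin d) :=
  (List.finRange d).flatMap fun i => List.replicate (k i) i

lemma length_multiWord {d : ℕ} (k : Fin d → ℕ) : (multiWord k).length = mdeg k := by
  simp [multiWord, mdeg, List.length_flatMap, Fin.sum_univ_def]

lemma wordDeriv_replicate {d : ℕ} (n : ℕ) (i : Fin d) (f : (Fin d → ℝ) → ℝ) :
    wordDeriv (List.replicate n i) f = (pd i)^[n] f := by
  induction n with
  | zero => rfl
  | succ n ih =>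
    rw [Function.iterate_succ_apply', ← ih, List.replicate_succ]
    rfl

lemma wordDeriv_append {d : ℕ} (v w : List (Fin d)) (f : (Fin d → ℝ) → ℝ) :
    wordDeriv (v ++ w) f = wordDeriv v (wordDeriv w f) :=
  List.foldr_append

lemma mpd_eq_wordDeriv {d : ℕ} (k : Fin d → ℕ) (f : (Fin d → ℝ) → ℝ) :
    mpd k f = wordDeriv (multiWord k) f := by
  unfold mpd multiWord
  induction List.finRange d with
  | nil => rfl
  | cons i L ih =>
    rw [List.foldr_cons, ih, List.flatMap_cons, wordDeriv_append, wordDeriv_replicate]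

lemma multiWord_add_perm {d : ℕ} (l k : Fin d → ℕ) :
    (multiWord l ++ multiWord k).Perm (multiWord (l + k)) := by
  simpa only [multiWord, Pi.add_apply, List.replicate_add] using
    List.flatMap_append_perm (List.finRange d)
      (fun i => List.replicate (l i) i) fun i => List.replicate (k i) i

lemma contDiff_pd {d n : ℕ} {f : (Fin d → ℝ) → ℝ} (hf : ContDiff ℝ (n + 1 : ℕ) f)
    (i : Fin d) : ContDiff ℝ n (pd i f) :=
  (hf.fderiv_right (m := n) (by norm_cast)).clm_apply contDiff_const

lemma contDiff_wordDeriv {d n : ℕ} {f : (Fin d → ℝ) → ℝ} (w : List (Fin d))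
    (hf : ContDiff ℝ (n + w.length : ℕ) f) : ContDiff ℝ n (wordDeriv w f) := by
  induction w generalizing n with
  | nil => exact hf
  | cons i w ih =>
    refine contDiff_pd (ih ?_) i
    rwa [List.length_cons, ← add_assoc, add_right_comm] at hf

lemma pd_pd_apply {d : ℕ} {f : (Fin d → ℝ) → ℝ} (hf : ContDiff ℝ 2 f) (i j : Fin d)
    (x : Fin d → ℝ) :
    pd i (pd j f) x = fderiv ℝ (fderiv ℝ f) x (Pi.single i 1) (Pi.single j 1) := by
  have h : DifferentiableAt ℝ (fderiv ℝ f) x :=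
    (hf.fderiv_right (m := 1) (by norm_num)).differentiable (by norm_num) x
  unfold pd
  rw [fderiv_clm_apply h (differentiableAt_const _)]
  simp

lemma pd_comm {d : ℕ} {f : (Fin d → ℝ) → ℝ} (hf : ContDiff ℝ 2 f) (i j : Fin d) :
    pd i (pd j f) = pd j (pd i f) := by
  ext x
  rw [pd_pd_apply hf, pd_pd_apply hf]
  exact (hf.contDiffAt.isSymmSndFDerivAt (by simp)).eq _ _

lemma wordDeriv_perm {d : ℕ} {v w : List (Fin d)} (h : v.Perm w) {f : (Fin d → ℝ) → ℝ}
    (hf : ContDiff ℝ v.length f) : wordDeriv v f = wordDeriv w f := by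
  induction h with
  | nil => rfl
  | cons i _ ih =>
    exact congrArg (pd i) (ih (hf.of_le (by simp)))
  | swap i j w =>
    refine pd_comm (contDiff_wordDeriv (n := 2) w (hf.of_le ?_)) j i
    norm_cast
    simp only [List.length_cons]
    omega
  | trans h₁ _ ih₁ ih₂ => exact (ih₁ hf).trans (ih₂ (h₁.length_eq ▸ hf))

lemma mpd_mpd {d : ℕ} (l k : Fin d → ℕ) {f : (Fin d → ℝ) → ℝ}
    (hf : ContDiff ℝ (mdeg l + mdeg k : ℕ) f) : mpd l (mpd k f) = mpd (l + k) f := by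
  simp only [mpd_eq_wordDeriv, ← wordDeriv_append]
  exact wordDeriv_perm (multiWord_add_perm l k) (by simpa [length_multiWord] using hf)

lemma mdeg_add {d : ℕ} (l k : Fin d → ℕ) : mdeg (l + k) = mdeg l + mdeg k :=
  Finset.sum_add_distrib

lemma le_mdeg {d : ℕ} (k : Fin d → ℕ) (i : Fin d) : k i ≤ mdeg k :=
  Finset.single_le_sum (f := k) (fun _ _ => Nat.zero_le _) (Finset.mem_univ i)

lemma mem_mIdx {d j : ℕ} {k : Fin d → ℕ} : k ∈ mIdx d j ↔ mdeg k = j := by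
  simp only [mIdx, Finset.mem_filter, Fintype.mem_piFinset, Finset.mem_range,
    and_iff_right_iff_imp]
  rintro rfl i
  exact Nat.lt_succ_of_le (le_mdeg k i)

/-- The multi-indices `l ≤ n` with `l. ≥ 1` and `l ≠ n`. -/
def properParts {d : ℕ} (n : Fin d → ℕ) : Finset (Fin d → ℕ) :=
  (Fintype.piFinset fun j => Finset.range (n j + 1)).filter fun l => 1 ≤ mdeg l ∧ l ≠ n

lemma mem_properParts {d : ℕ} {n l : Fin d → ℕ} :
    l ∈ properParts n ↔ l ≤ n ∧ 1 ≤ mdeg l ∧ 1 ≤ mdeg (n - l) := by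
  simp only [properParts, Finset.mem_filter, Fintype.mem_piFinset, Finset.mem_range,
    Nat.lt_succ_iff, ← Pi.le_def]
  refine and_congr_right fun hle => and_congr_right fun _ => ?_
  rw [Nat.one_le_iff_ne_zero, not_iff_not]
  constructor
  · rintro rfl
    simp [mdeg]
  · intro h
    refine le_antisymm hle fun i => ?_
    change n i ≤ l i
    have := le_mdeg (n - l) i
    simp only [Pi.sub_apply] at this
    omega

lemma mdeg_add_mdeg_sub {d : ℕ} {n l : Fin d → ℕ} (h : l ≤ n) :
    mdeg l + mdeg (n - l) = mdeg n := by
  rw [← mdeg_add, add_tsub_cancel_of_le h]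

lemma dAux_eq_dcoef {d : ℕ} (p : (Fin d → ℝ) → ℝ) {N : ℕ} {n : Fin d → ℕ}
    (h1 : 1 ≤ mdeg n) (hN : mdeg n ≤ N) : dAux p N n = dcoef p n := by
  induction N using Nat.strong_induction_on generalizing n with
  | _ N ih =>
    obtain ⟨M, rfl⟩ : ∃ M, N = M + 1 := ⟨N - 1, by omega⟩
    obtain ⟨m, hm⟩ : ∃ m, mdeg n = m + 1 := ⟨mdeg n - 1, by omega⟩
    rw [dcoef, hm, dAux, dAux]
    congr 2
    refine Finset.sum_congr rfl fun l hl => ?_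
    obtain ⟨hle, hl1, hl2⟩ := mem_properParts.1 hl
    have := mdeg_add_mdeg_sub hle
    rw [ih M (by omega) hl1 (by omega)]
    obtain rfl | hlt := (show m ≤ M by omega).eq_or_lt
    · rw [ih m (by omega) hl1 (by omega)]
    · rw [ih m (by omega) hl1 (by omega)]

lemma ccoef_eq {d : ℕ} (p : (Fin d → ℝ) → ℝ) {n : Fin d → ℕ} (h1 : 1 ≤ mdeg n) :
    ccoef p n = -∑ l ∈ properParts n,
      ((-1 : ℝ) ^ mdeg (n - l) / (mfact (n - l) : ℝ)) * mmom p (n - l) * dcoef p l := by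
  unfold ccoef
  split_ifs with h
  · rw [Finset.sum_eq_zero, neg_zero]
    intro l hl
    obtain ⟨hle, hl1, hl2⟩ := mem_properParts.1 hl
    have := mdeg_add_mdeg_sub hle
    omega
  · obtain ⟨m, hm⟩ : ∃ m, mdeg n = m + 1 := ⟨mdeg n - 1, by omega⟩
    rw [dcoef, hm, dAux, if_neg (by omega), hm, sub_sub_cancel_left, neg_inj]
    refine Finset.sum_congr rfl fun l hl => ?_
    obtain ⟨hle, hl1, hl2⟩ := mem_properParts.1 hl
    have := mdeg_add_mdeg_sub hle
    rw [dAux_eq_dcoef p hl1 (by omega)]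

/-- Regrouping of a double sum over pairs `(k, l)` of multi-indices by `n = l + k`. -/
lemma sum_mIdx_regroup {d : ℕ} (β : ℕ) (F : (Fin d → ℕ) → (Fin d → ℕ) → ℝ) :
    ∑ j ∈ Finset.Icc 1 β, ∑ k ∈ mIdx d j, ∑ i ∈ Finset.Icc 1 (β - j), ∑ l ∈ mIdx d i, F k l =
      ∑ j ∈ Finset.Icc 1 β, ∑ n ∈ mIdx d j, ∑ l ∈ properParts n, F (n - l) l := by
  simp only [Finset.sum_sigma']
  refine Finset.sum_bij'
    (fun a _ => ⟨mdeg (a.2.2.2 + a.2.1), a.2.2.2 + a.2.1, a.2.2.2⟩)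
    (fun b _ => ⟨mdeg (b.2.1 - b.2.2), b.2.1 - b.2.2, mdeg b.2.2, b.2.2⟩) ?_ ?_ ?_ ?_ ?_
  · rintro ⟨j, k, i, l⟩ h
    simp only [Finset.mem_sigma, Finset.mem_Icc, mem_mIdx] at h
    have := mdeg_add l k
    simp only [Finset.mem_sigma, Finset.mem_Icc, mem_mIdx, mem_properParts, add_tsub_cancel_left]
    exact ⟨⟨by omega, by omega⟩, trivial, le_self_add, by omega, by omega⟩
  · rintro ⟨j, n, l⟩ h
    simp only [Finset.mem_sigma, Finset.mem_Icc, mem_mIdx, mem_properParts] at h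
    have := mdeg_add_mdeg_sub h.2.2.1
    simp only [Finset.mem_sigma, Finset.mem_Icc, mem_mIdx, and_true, true_and]
    omega
  · rintro ⟨j, k, i, l⟩ h
    simp only [Finset.mem_sigma, mem_mIdx] at h
    obtain ⟨-, rfl, -, rfl⟩ := h
    simp only [add_tsub_cancel_left]
  · rintro ⟨j, n, l⟩ h
    simp only [Finset.mem_sigma, mem_mIdx, mem_properParts] at h
    obtain ⟨-, rfl, hle, -⟩ := h
    simp only [add_tsub_cancel_of_le hle]
  · rintro ⟨j, k, i, l⟩ _
    simp only [add_tsub_cancel_left]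

/-- **The key algebraic identity in the proof of Lemma 3.4.** For an integrable kernel
`p` with all moments finite and `f` with continuous bounded partial derivatives up to
order `β ≥ 1`, for every `σ > 0` and `x ∈ ℝ^d`:
`∑_{j=1}^{β} ∑_{k.=j} [((-1)^j/k!) σ^j m_k ((T^{(β-j)}_σ(D^j_k f))(x) - (D^j_k f)(x))
  - c_k σ^j (D^j_k f)(x)] = 0`. -/
theorem transform_telescoping_identity
    {d : ℕ} (hd : 0 < d) {p : (Fin d → ℝ) → ℝ}
    (hpint : Integrable p)
    (hpmom : ∀ k : ℕ, Integrable fun x => ‖x‖ ^ k * |p x|)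
    {β : ℕ} (hβ : 1 ≤ β) {f : (Fin d → ℝ) → ℝ}
    (hf : ContDiff ℝ β f)
    (hfb : ∀ i ≤ β, ∃ C : ℝ, ∀ x, ‖iteratedFDeriv ℝ i f x‖ ≤ C) :
    ∀ σ : ℝ, 0 < σ → ∀ x : Fin d → ℝ,
      ∑ j ∈ Finset.Icc 1 β, ∑ k ∈ mIdx d j,
        (((-1 : ℝ) ^ j / (mfact k : ℝ)) * σ ^ j * mmom p k *
            (Tb p (β - j) σ (mpd k f) x - mpd k f x)
          - ccoef p k * σ ^ j * mpd k f x) = 0 := by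
  intro σ _ x
  have hT : ∀ j ∈ Finset.Icc 1 β, ∀ k ∈ mIdx d j,
      ((-1 : ℝ) ^ j / (mfact k : ℝ)) * σ ^ j * mmom p k *
          (Tb p (β - j) σ (mpd k f) x - mpd k f x) =
        -∑ i ∈ Finset.Icc 1 (β - j), ∑ l ∈ mIdx d i,
          ((-1 : ℝ) ^ mdeg k / (mfact k : ℝ)) * mmom p k * dcoef p l *
            (σ ^ mdeg (l + k) * mpd (l + k) f x) := by
    intro j hj k hk
    obtain rfl := mem_mIdx.1 hk
    rw [Tb, sub_sub_cancel_left, mul_neg, Finset.mul_sum]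
    refine congrArg Neg.neg (Finset.sum_congr rfl fun i hi => ?_)
    rw [Finset.mul_sum]
    refine Finset.sum_congr rfl fun l hl => ?_
    obtain rfl := mem_mIdx.1 hl
    rw [Finset.mem_Icc] at hi hj
    rw [mpd_mpd l k (hf.of_le (by norm_cast; omega)), mdeg_add, pow_add]
    ring
  have hC : ∀ j ∈ Finset.Icc 1 β, ∀ n ∈ mIdx d j,
      ccoef p n * σ ^ j * mpd n f x =
        -∑ l ∈ properParts n,
          ((-1 : ℝ) ^ mdeg (n - l) / (mfact (n - l) : ℝ)) * mmom p (n - l) * dcoef p l *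
            (σ ^ mdeg (l + (n - l)) * mpd (l + (n - l)) f x) := by
    intro j hj n hn
    obtain rfl := mem_mIdx.1 hn
    rw [ccoef_eq p (Finset.mem_Icc.1 hj).1, mul_assoc, neg_mul, Finset.sum_mul]
    refine congrArg Neg.neg (Finset.sum_congr rfl fun l hl => ?_)
    rw [add_tsub_cancel_of_le (mem_properParts.1 hl).1]
  simp only [Finset.sum_sub_distrib]
  rw [sub_eq_zero, Finset.sum_congr rfl fun j hj => Finset.sum_congr rfl (hT j hj),
    Finset.sum_congr rfl fun j hj => Finset.sum_congr rfl (hC j hj)]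
  simp only [Finset.sum_neg_distrib]
  exact congrArg Neg.neg (sum_mIdx_regroup β fun k l =>
    ((-1 : ℝ) ^ mdeg k / (mfact k : ℝ)) * mmom p k * dcoef p l *
      (σ ^ mdeg (l + k) * mpd (l + k) f x))
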